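/- From the position R2, placing a chap at d5 is Alfred's unique non-losing move: after Alfred places a chap at d5, Betty has no winning strategy from the resulting position, while after every other legal move of Alfred from R2, Betty has a winning strategy from the resulting position. -/

import Mathlib

/-!
Formalization of Philosophers' Phutball on an `m × n` board (`m` rows, `n` columns).
Points are pairs `(column, row)` of integers, with columns `1, …, n` (a, b, c, …)
and rows `1, …, m` (bottom to top).  Player `true` is Alfred (first player, aims
for the top row `m`); player `false` is Betty (aims for the bottom row `1`).
-/

/-- A player: `true` is Alfred, `false` is Betty. -/
abbrev Player := Bool

/-- A Phutball position: the ball's point `(column, row)`, the finite set of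
chaps, and the player whose turn it is. -/
structure PState where
  ball : ℤ × ℤ
  chaps : Finset (ℤ × ℤ)
  turn : Player
deriving DecidableEq

/-- The eight horizontal, vertical and diagonal directions. -/
def dirs : Finset (ℤ × ℤ) :=
  {(1, 0), (1, 1), (0, 1), (-1, 1), (-1, 0), (-1, -1), (0, -1), (1, -1)}

/-- The point reached from `b` after `i` steps in direction `d`. -/
def ray (b d : ℤ × ℤ) (i : ℤ) : ℤ × ℤ := (b.1 + i * d.1, b.2 + i * d.2)

/-- A point is on the `m × n` board. -/
def OnBoard (m n : ℤ) (p : ℤ × ℤ) : Prop :=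
  1 ≤ p.1 ∧ p.1 ≤ n ∧ 1 ≤ p.2 ∧ p.2 ≤ m

/-- A single hop on a board with `n` columns: the ball at `b` moves in one of the
eight directions `d` over a contiguous nonempty line of `k` chaps, landing on the
first point beyond them that carries no chap; the jumped-over chaps are removed.
The landing point must not lie onto or past the sidelines (outside columns
`1, …, n`), but it may lie past the top or bottom row. -/
def Hop (n : ℤ) (b : ℤ × ℤ) (c : Finset (ℤ × ℤ)) (b' : ℤ × ℤ) (c' : Finset (ℤ × ℤ)) : Prop :=
  ∃ d ∈ dirs, ∃ k : ℕ, 1 ≤ k ∧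
    (∀ i : ℕ, 1 ≤ i → i ≤ k → ray b d i ∈ c) ∧
    ray b d (k + 1) ∉ c ∧
    1 ≤ (ray b d (k + 1)).1 ∧ (ray b d (k + 1)).1 ≤ n ∧
    b' = ray b d (k + 1) ∧
    c' = c \ Finset.image (fun i : ℕ => ray b d i) (Finset.Icc 1 k)

/-- A jump is a nonempty sequence of hops (the player may stop after any hop,
and the removed chaps cannot be re-used by later hops of the same jump).  The
jump can continue after a hop only if the ball has not been carried past the top
or bottom row (which would end the game immediately). -/
inductive Jump (m n : ℤ) : ℤ × ℤ → Finset (ℤ × ℤ) → ℤ × ℤ → Finset (ℤ × ℤ) → Prop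
  | single {b c b' c'} : Hop n b c b' c' → Jump m n b c b' c'
  | cons {b c b₁ c₁ b' c'} : Hop n b c b₁ c₁ → 1 ≤ b₁.2 → b₁.2 ≤ m →
      Jump m n b₁ c₁ b' c' → Jump m n b c b' c'

/-- The winner, if any, of a position (evaluated between turns): Alfred wins if
the ball rests on the top row `m` or has been carried past it; Betty wins if the
ball rests on the bottom row `1` or has been carried past it. -/
def winner (m : ℤ) (s : PState) : Option Player :=
  if m ≤ s.ball.2 then some true else if s.ball.2 ≤ 1 then some false else none

/-- A single legal move on the `m × n` board: the player to move either places a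
chap on a vacant on-board point, or moves the ball by a jump; the turn passes to
the other player. -/
def MoveRel (m n : ℤ) (s t : PState) : Prop :=
  t.turn = !s.turn ∧
    ((∃ p, OnBoard m n p ∧ p ∉ s.chaps ∧ p ≠ s.ball ∧
        t.ball = s.ball ∧ t.chaps = insert p s.chaps) ∨
      Jump m n s.ball s.chaps t.ball t.chaps)

/-- An infinite record of play: while the game is not over and a legal move
exists, a legal move is made; otherwise the position is frozen forever. -/
def IsPlay (m n : ℤ) (f : ℕ → PState) : Prop :=
  ∀ k,
    (winner m (f k) = none ∧ (∃ t, MoveRel m n (f k) t) ∧ MoveRel m n (f k) (f (k + 1))) ∨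
    ((winner m (f k) ≠ none ∨ ¬ ∃ t, MoveRel m n (f k) t) ∧ f (k + 1) = f k)

/-- A strategy for player `p` that always proposes a legal move whenever the game
is not over, it is `p`'s turn, and some legal move exists. -/
def LegalStrategy (m n : ℤ) (p : Player) (σ : PState → PState) : Prop :=
  ∀ s, s.turn = p → winner m s = none → (∃ t, MoveRel m n s t) → MoveRel m n s (σ s)

/-- The play `f` follows the strategy `σ` of player `p`. -/
def Follows (m n : ℤ) (p : Player) (σ : PState → PState) (f : ℕ → PState) : Prop :=
  ∀ k, (f k).turn = p → winner m (f k) = none → (∃ t, MoveRel m n (f k) t) →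
    f (k + 1) = σ (f k)

/-- Player `p` has a winning strategy from `s₀` on the `m × n` board: a legal
strategy guaranteeing that, against every play of the opponent, `p` wins after
finitely many moves. -/
def WinsFrom (m n : ℤ) (p : Player) (s₀ : PState) : Prop :=
  ∃ σ, LegalStrategy m n p σ ∧
    ∀ f, IsPlay m n f → f 0 = s₀ → Follows m n p σ f → ∃ k, winner m (f k) = some p

/-- Player `p` has a drawing strategy from `s₀` on the `m × n` board: a legal
strategy guaranteeing that the opponent never wins (play may continue forever). -/
def DrawsFrom (m n : ℤ) (p : Player) (s₀ : PState) : Prop :=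
  ∃ σ, LegalStrategy m n p σ ∧
    ∀ f, IsPlay m n f → f 0 = s₀ → Follows m n p σ f → ∀ k, winner m (f k) ≠ some (!p)

/-- A position is drawn if both players have drawing strategies from it. -/
def Drawn (m n : ℤ) (s : PState) : Prop :=
  DrawsFrom m n true s ∧ DrawsFrom m n false s

/-- The chaps of the position `R0` on the official 19 × 15 board:
c1, c2, c5, c7, c9–c19, d6, e4, e11–e19, f1, f2, f9, g6, g13–g19,
h1, h2, h3, h4, h11, i8, i15–i19, j1–j6, j13, k11, l1–l8, l10, l12, l15–l19,
n17, n18, n19, and o1–o19. -/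
def R0chaps : Finset (ℤ × ℤ) :=
  {(3, 1), (3, 2), (3, 5), (3, 7), (3, 9), (3, 10), (3, 11), (3, 12), (3, 13), (3, 14), (3, 15), (3, 16), (3, 17), (3, 18), (3, 19), (4, 6), (5, 4), (5, 11), (5, 12), (5, 13), (5, 14), (5, 15), (5, 16), (5, 17), (5, 18), (5, 19), (6, 1), (6, 2), (6, 9), (7, 6), (7, 13), (7, 14), (7, 15), (7, 16), (7, 17), (7, 18), (7, 19), (8, 1), (8, 2), (8, 3), (8, 4), (8, 11), (9, 8), (9, 15), (9, 16), (9, 17), (9, 18), (9, 19), (10, 1), (10, 2), (10, 3), (10, 4), (10, 5), (10, 6), (10, 13), (11, 11), (12, 1), (12, 2), (12, 3), (12, 4), (12, 5), (12, 6), (12, 7), (12, 8), (12, 10), (12, 12), (12, 15), (12, 16), (12, 17), (12, 18), (12, 19), (14, 17), (14, 18), (14, 19), (15, 1), (15, 2), (15, 3), (15, 4), (15, 5), (15, 6), (15, 7), (15, 8), (15, 9), (15, 10), (15, 11), (15, 12), (15, 13), (15, 14), (15, 15), (15, 16), (15, 17), (15, 18), (15, 19)}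

/-- The position `R0`: ball at a2 = (1, 2), the chaps above, Alfred to move. -/
def R0 : PState := ⟨(1, 2), R0chaps, true⟩

/-- The position `R2`: `R0` with additional chaps at b3 and c4, Alfred to move. -/
def R2 : PState := ⟨(1, 2), R0chaps ∪ {(2, 3), (3, 4)}, true⟩

/-- The result of Alfred placing a chap at d5 = (4, 5) from `R2`. -/
def R2_d5 : PState := ⟨(1, 2), insert (4, 5) R2.chaps, false⟩

namespace Phutball

/-! ### Computing with encoded positions

The point `(x, y)` is encoded as the number `16 * y + x` and a set of points as a bitmask.
The direction `(u, v)` is encoded as `17 + u + 16 * v`. All definitions are arranged so that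
they evaluate efficiently in the kernel. -/

/-- Function application that evaluates the argument first. -/
def force {α : Type} (n : ℕ) (f : ℕ → α) : α :=
  Nat.rec (f 0) (fun m _ => f m.succ) n

/-- The bit of the mask `c` at `i`. -/
def bit (c i : ℕ) : Bool := Nat.beq (Nat.land 1 (Nat.shiftRight c (Nat.add i 32))) 1

/-- The number to be combined with a set of points to add or remove the point `i`. -/
def key (i : ℕ) : ℕ := Nat.add (Nat.shiftLeft 1 (Nat.add i 32)) (Nat.mod (Nat.pow i 7) 4294967291)

/-- Add the encoded point `i` to the set `c`, or remove it from `c`. -/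
def toggle (c i : ℕ) : ℕ := Nat.xor c (key i)

/-- Whether the encoded point `i` lies in one of the columns `1, …, 15`. -/
def inColumns (i : ℕ) : Bool := Nat.blt 0 (Nat.land i 15)

/-- Whether the encoded point `i` lies in one of the rows `1, …, 19`. -/
def inRows (i : ℕ) : Bool := cond (Nat.ble 16 i) (Nat.blt i 320) false

/-- Whether the ball at `b` lies on or past the goal row that player `p` aims for. -/
def goal (p : Player) (b : ℕ) : Bool := cond p (Nat.ble 304 b) (Nat.blt b 32)

/-- Whether a ball at `b` is strictly between the goal rows. -/
def live (b : ℕ) : Bool := cond (Nat.ble 32 b) (Nat.blt b 304) false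

/-- Slide in direction `e` from `i`, removing chaps, up to the first point without a chap. -/
def slide : ℕ → ℕ → ℕ → ℕ → Option (ℕ × ℕ)
  | 0, _, _, _ => none
  | f + 1, e, i, c =>
    cond (bit c i)
      (force (Nat.sub (Nat.add i e) 17) fun j => force (toggle c i) fun c' => slide f e j c')
      (cond (inColumns i) (some (i, c)) none)

/-- The result of a hop in direction `e`. -/
def hop (b c e : ℕ) : Option (ℕ × ℕ) :=
  force (Nat.sub (Nat.add b e) 17) fun i => cond (bit c i) (slide 20 e i c) none

/-- The eight directions, ordered by their promise for player `p`. -/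
def dirCodes (p : Player) : List ℕ :=
  cond p [33, 34, 32, 18, 16, 0, 1, 2] [1, 0, 2, 16, 18, 32, 33, 34]

/-- Search for a jump reaching the goal of player `p`; the result lists the landing points. -/
def threat (p : Player) : ℕ → ℕ → ℕ → Option (List ℕ)
  | 0, _, _ => none
  | f + 1, b, c => (dirCodes p).findSome? fun e =>
    (hop b c e).bind fun r =>
      cond (goal p r.1) (some [r.1])
        (cond (inRows r.1) ((threat p f r.1 r.2).map (List.cons r.1)) none)

/-- All positions reached by a jump are won by `p` immediately, or are live and satisfy `W`. -/
def allJumps (p : Player) (W : ℕ → ℕ → Bool) : ℕ → ℕ → ℕ → Bool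
  | 0, _, _ => false
  | f + 1, b, c => (dirCodes p).all fun e =>
    (hop b c e).all fun r =>
      cond (cond (live r.1) (W r.1 r.2) (goal p r.1))
        (cond (inRows r.1) (allJumps p W f r.1 r.2) true) false

/-- Whether a chap may be placed at `q`. -/
def vacant (b c q : ℕ) : Bool :=
  cond (inRows q) (cond (inColumns q) (cond (bit c q) false (cond (Nat.beq q b) false true)) false)
    false

/-- Placing a chap at `q`, if possible, leads to a position satisfying `W`. -/
def okPlace (W : ℕ → ℕ → Bool) (b c q : ℕ) : Bool :=
  cond (vacant b c q) (force (toggle c q) (W b)) true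

/-- Whether all moves of the opponent of `p` lead to positions won immediately by `p` or
satisfying `W`. -/
def allMoves (p : Player) (W : ℕ → ℕ → Bool) (b c : ℕ) : Bool :=
  cond (allJumps p W 50 b c) ((List.range 320).all (okPlace W b c)) false

/-- Like `allMoves`, but `p` is required to threaten to win, and `W` is only evaluated for
placements interfering with the threat. -/
def forced (p : Player) (W : ℕ → ℕ → Bool) (b c : ℕ) : Bool :=
  cond (allJumps p W 50 b c) ((threat p 10 b c).any fun l => l.all (okPlace W b c)) false

/-- Whether player `p`, who is to move, can win at once by a jump. -/
def canJump (p : Player) (b c : ℕ) : Bool := (threat p 10 b c).isSome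

/-- Whether player `p`, who is to move, can place a chap at `q` to reach a position satisfying
`L`. -/
def canPlace (L : ℕ → ℕ → Bool) (b c q : ℕ) : Bool :=
  cond (vacant b c q) (force (toggle c q) (L b)) false

/-- Whether player `p`, who is to move, can win by making threats. The lists contain the points
to be tried for a placement; the number `0` stands for an immediate win by a jump. -/
def wins (p : Player) : List (List ℕ) → ℕ → ℕ → Bool
  | [], b, c => canJump p b c
  | l :: h, b, c => l.any fun q =>
    cond (Nat.beq q 0) (canJump p b c) (canPlace (forced p (wins p h)) b c q)

/-- All hops carry the ball off the board past the goal row of `p`. -/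
def safe (p : Player) (b c : ℕ) : Bool := (dirCodes p).all fun e =>
  (hop b c e).all fun r => cond (inRows r.1) false (goal p r.1)

/-- Whether `p`, whose opponent is to move, wins because the opponent can only prevent a threat
by placing a chap next to the ball, which allows for a jump to the goal. The threat consists in
placing a chap at `q`. -/
def quiet (p : Player) (q b c : ℕ) : Bool :=
  cond (vacant b c q) (cond (safe p b c) (force (toggle c q) fun c' => cond (safe p b c')
    (cond ((threat p 10 b c').any fun l => l.all fun i => Nat.ble 320 i)
      ((dirCodes p).all fun e => okPlace (canJump p) b c (Nat.sub (Nat.add b e) 17)) false)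
    false) false) false

/-- The code of the point `(x, y)`. -/
def pt (x y : ℕ) : ℕ := Nat.add (Nat.mul 16 y) x

/-- The code of `R0chaps`. -/
def r0 : ℕ :=
  7549174844776833324419537373494494478606657007650440980867809247347890238426441840398801603329942114042851

/-- The code of `R0chaps` with the points `(x, x + 1)` for `u ≤ x < u + n` added. -/
def ladder (u : ℕ) : ℕ → ℕ
  | 0 => r0
  | n + 1 => toggle (ladder u n) (pt (Nat.add u n) (Nat.add u n.succ))

/-- The drawing cycle: the codes of the ball and of the chaps after `j` moves from `R0`. -/
def cycle (j : ℕ) : ℕ × ℕ :=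
  cond (Nat.ble j 12) (pt 1 2, ladder 2 j) (pt 14 15, ladder (Nat.sub 27 j) (Nat.sub j 13))

/-- Whether the position with the code `r` has the ball at `b` and the chaps `c`. -/
def eqPos (r : ℕ × ℕ) (b c : ℕ) : Bool := cond (Nat.beq b r.1) (Nat.beq c r.2) false

/-- Whether the move of Alfred in the drawing cycle after `j` moves is legal. -/
def cycleMove (j : ℕ) : Bool :=
  cond (Nat.beq j 12) ((hop (cycle j).1 (cycle j).2 34).any fun r => eqPos (cycle 13) r.1 r.2)
    (canPlace (eqPos (cycle (Nat.succ j))) (cycle j).1 (cycle j).2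
      (cond (Nat.ble j 12) (pt (Nat.add j 2) (Nat.add j 3)) (pt (Nat.sub 26 j) (Nat.sub 27 j))))

/-- The placements with which Alfred refutes deviations of Betty from the drawing cycle. -/
def hints (j : ℕ) : List (List ℕ) :=
  cond (Nat.beq j 13) [[pt 14 16, 0], [0, pt 13 14]] (cond (Nat.beq j 25)
    [[pt 14 16], [pt 2 3], [0, pt 4 6, pt 4 5], [0, pt 3 5, pt 6 7], [0, pt 8 9], [0, pt 10 11],
      [0, pt 12 13, pt 13 13, pt 13 11, pt 10 10, pt 12 11],
      [0, pt 12 17, pt 12 10, pt 13 11, pt 12 12, pt 13 13, pt 9 14, pt 10 10]]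
    [[0, pt 3 5, pt 4 6, pt 10 10, pt 12 11, pt 13 13],
      [0, pt 12 10, pt 13 11, pt 12 12, pt 13 13]])

/-- Whether the position reached by the move of Betty after `j` moves of the drawing cycle belongs
to the drawing cycle or is won by Alfred. -/
def reply (j b c : ℕ) : Bool :=
  cond (eqPos (cycle (Nat.mod (Nat.succ j) 26)) b c) true
    (cond (cond (Nat.beq j 25)
      (cond (canJump true b c) true (canPlace (quiet true (pt 14 16)) b c (pt 1 2))) false) true
      (wins true (hints j) b c))

/-- Whether the position reached by a move of Alfred from `R2` is `R2_d5` or is won by Betty. -/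
def replyR2 (b c : ℕ) : Bool :=
  cond (eqPos (cycle 3) b c) true
    (wins false [[0, pt 3 6, pt 2 6, pt 2 4], [0, pt 2 4]] b c)

theorem allMoves_R2 : allMoves false replyR2 (cycle 2).1 (cycle 2).2 = true := by
  decide +kernel

theorem cycleMove_even : ∀ i < 13, cycleMove (2 * i) = true := by
  decide +kernel

theorem allMoves_odd : ∀ i < 13,
    allMoves true (reply (2 * i + 1)) (cycle (2 * i + 1)).1 (cycle (2 * i + 1)).2 = true := by
  decide +kernel

theorem live_cycle : ∀ j < 26, live (cycle j).1 = true := by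
  decide +kernel

theorem force_eq {α : Type} (n : ℕ) (f : ℕ → α) : force n f = f n := by
  cases n <;> rfl

theorem bit_eq_testBit (c i : ℕ) : bit c i = c.testBit (i + 32) := by
  have h : bit c i = (1 &&& c >>> (i + 32)).beq 1 := rfl
  rw [h, Nat.testBit, Nat.one_and_eq_mod_two]
  rcases Nat.mod_two_eq_zero_or_one (c >>> (i + 32)) with h | h <;> rw [h] <;> rfl

theorem testBit_key (i j : ℕ) : (key i).testBit (j + 32) = decide (i = j) := by
  have hlt : i ^ 7 % 4294967291 < 2 ^ (i + 32) :=
    (Nat.mod_lt _ (by norm_num)).trans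
      (lt_of_lt_of_le (by norm_num) (Nat.pow_le_pow_right (by norm_num) (Nat.le_add_left 32 i)))
  have h : key i = 2 ^ (i + 32) * 1 + i ^ 7 % 4294967291 := by
    change 1 <<< (i + 32) + i ^ 7 % 4294967291 = _
    rw [Nat.shiftLeft_eq, one_mul, mul_one]
  rw [h, Nat.testBit_two_pow_mul_add _ hlt]
  split_ifs with hj
  · rw [Nat.testBit_eq_false_of_lt, eq_comm, decide_eq_false_iff_not]
    · omega
    · exact (Nat.mod_lt _ (by norm_num)).trans
        (lt_of_lt_of_le (by norm_num) (Nat.pow_le_pow_right (by norm_num) (Nat.le_add_left 32 j)))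
  · rw [Bool.eq_iff_iff, Nat.testBit_one_eq_true_iff_self_eq_zero, decide_eq_true_iff]
    omega

theorem bit_toggle (c i j : ℕ) : bit (toggle c i) j = (bit c j ^^ decide (i = j)) := by
  rw [bit_eq_testBit, bit_eq_testBit, ← testBit_key]
  exact Nat.testBit_xor ..

theorem inColumns_iff (i : ℕ) : inColumns i = true ↔ 0 < i % 16 := by
  have h : i &&& 15 = i % 16 := Nat.and_two_pow_sub_one_eq_mod i 4
  change Nat.blt 0 (i &&& 15) = true ↔ _
  rw [h, Nat.blt_eq]

theorem inRows_iff (i : ℕ) : inRows i = true ↔ 16 ≤ i ∧ i < 320 := by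
  rw [inRows, Bool.cond_false_right, Bool.and_eq_true, Nat.ble_eq, Nat.blt_eq]

theorem live_iff (b : ℕ) : live b = true ↔ 32 ≤ b ∧ b < 304 := by
  rw [live, Bool.cond_false_right, Bool.and_eq_true, Nat.ble_eq, Nat.blt_eq]

theorem vacant_iff (b c q : ℕ) :
    vacant b c q = true ↔ inRows q = true ∧ inColumns q = true ∧ bit c q = false ∧ q ≠ b := by
  rw [vacant, Ne, ← Nat.beq_eq]
  cases inRows q <;> cases inColumns q <;> cases bit c q <;> cases Nat.beq q b <;> simp

/-- The number `i` encodes the point `P`. -/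
def Code (i : ℕ) (P : ℤ × ℤ) : Prop := (i : ℤ) = 16 * P.2 + P.1

/-- The bitmask `c` encodes the set `C` of points on the board. -/
structure CodeSet (c : ℕ) (C : Finset (ℤ × ℤ)) : Prop where
  onBoard : ∀ P ∈ C, OnBoard 19 15 P
  bit_iff : ∀ i, bit c i = true ↔ ∃ P ∈ C, Code i P

/-- The numbers `b` and `c` encode the ball and the chaps of a position. -/
structure Codes (b c : ℕ) (B : ℤ × ℤ) (C : Finset (ℤ × ℤ)) : Prop where
  ball : Code b B
  left : 1 ≤ B.1
  right : B.1 ≤ 15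
  chaps : CodeSet c C

theorem Code.eq {i : ℕ} {P Q : ℤ × ℤ} (hP : Code i P) (hQ : Code i Q) (hP₁ : 0 ≤ P.1)
    (hP₂ : P.1 ≤ 16) (hQ₁ : 1 ≤ Q.1) (hQ₂ : Q.1 ≤ 15) : P = Q := by
  unfold Code at hP hQ
  ext <;> omega

theorem CodeSet.bit_iff_mem {c i : ℕ} {C : Finset (ℤ × ℤ)} {P : ℤ × ℤ} (h : CodeSet c C)
    (hi : Code i P) (h₁ : 0 ≤ P.1) (h₂ : P.1 ≤ 16) : bit c i = true ↔ P ∈ C := by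
  rw [h.bit_iff]
  refine ⟨fun ⟨Q, hQ, hiQ⟩ => ?_, fun hP => ⟨P, hP, hi⟩⟩
  have := h.onBoard Q hQ
  rwa [hi.eq hiQ h₁ h₂ this.1 this.2.1]

theorem CodeSet.eq {c : ℕ} {C D : Finset (ℤ × ℤ)} (hC : CodeSet c C) (hD : CodeSet c D) :
    C = D := by
  have key : ∀ {C D : Finset (ℤ × ℤ)}, CodeSet c C → CodeSet c D → C ⊆ D := by
    intro C D hC hD P hP
    have hb := hC.onBoard P hP
    unfold OnBoard at hb
    have hi : Code (16 * P.2 + P.1).toNat P := by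
      unfold Code
      omega
    rw [← hD.bit_iff_mem hi (by omega) (by omega)]
    exact (hC.bit_iff _).2 ⟨P, hP, hi⟩
  exact (key hC hD).antisymm (key hD hC)

theorem CodeSet.insert {c i : ℕ} {C : Finset (ℤ × ℤ)} {P : ℤ × ℤ} (h : CodeSet c C)
    (hi : Code i P) (hP : OnBoard 19 15 P) (hPC : P ∉ C) : CodeSet (toggle c i) (insert P C) where
  onBoard := by simpa [hP] using h.onBoard
  bit_iff j := by
    rw [bit_toggle]
    by_cases hij : i = j
    · subst hij
      have : bit c i = false := by
        rw [← Bool.not_eq_true, h.bit_iff_mem hi (by linarith [hP.1]) (by linarith [hP.2.1])]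
        exact hPC
      simp [this, hi]
    · have : ¬ Code j P := fun hj => hij (by unfold Code at hi hj; omega)
      simp [hij, h.bit_iff, this]

theorem CodeSet.erase {c i : ℕ} {C : Finset (ℤ × ℤ)} {P : ℤ × ℤ} (h : CodeSet c C)
    (hi : Code i P) (hPC : P ∈ C) : CodeSet (toggle c i) (C.erase P) where
  onBoard Q hQ := h.onBoard Q (Finset.mem_of_mem_erase hQ)
  bit_iff j := by
    have hP := h.onBoard P hPC
    rw [bit_toggle]
    by_cases hij : i = j
    · subst hij
      rw [(h.bit_iff i).2 ⟨P, hPC, hi⟩]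
      simp only [decide_true, Bool.xor_self, Bool.false_eq_true, false_iff, not_exists, not_and]
      intro Q hQ hiQ
      have hQ' := h.onBoard Q (Finset.mem_of_mem_erase hQ)
      refine Finset.ne_of_mem_erase hQ (hiQ.eq hi ?_ ?_ hP.1 hP.2.1)
      · linarith [hQ'.1]
      · linarith [hQ'.2.1]
    · rw [decide_eq_false hij, Bool.xor_false, h.bit_iff]
      refine exists_congr fun Q => and_congr_left fun hj => ?_
      rw [Finset.mem_erase, iff_and_self]
      rintro - rfl
      unfold Code at hi hj
      omega

/-- The first `k` points from `P` on in direction `d` carry chaps, and the next one does not. -/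
def Run (C : Finset (ℤ × ℤ)) (P d : ℤ × ℤ) (k : ℕ) : Prop :=
  (∀ j < k, ray P d j ∈ C) ∧ ray P d k ∉ C

theorem ray_zero (P d : ℤ × ℤ) : ray P d 0 = P := by
  simp [ray]

theorem ray_ray (P d : ℤ × ℤ) (i j : ℤ) : ray (ray P d i) d j = ray P d (i + j) := by
  simp only [ray, Prod.mk.injEq]
  constructor <;> ring

theorem Run.eq {C : Finset (ℤ × ℤ)} {P d : ℤ × ℤ} {k l : ℕ} (hk : Run C P d k)
    (hl : Run C P d l) : k = l := by
  rcases lt_trichotomy k l with h | h | h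
  · exact absurd (hl.1 k h) hk.2
  · exact h
  · exact absurd (hk.1 l h) hl.2

theorem dirs_bounds {d : ℤ × ℤ} (hd : d ∈ dirs) :
    d ≠ 0 ∧ -1 ≤ d.1 ∧ d.1 ≤ 1 ∧ -1 ≤ d.2 ∧ d.2 ≤ 1 := by
  revert d
  decide

theorem Run.le {C : Finset (ℤ × ℤ)} {P d : ℤ × ℤ} {k : ℕ} (hd : d ∈ dirs)
    (hC : ∀ P ∈ C, OnBoard 19 15 P) (hk : Run C P d k) : k ≤ 19 := by
  by_contra! h
  have h₀ := hC _ (hk.1 0 (by omega))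
  have h₁ := hC _ (hk.1 19 (by omega))
  simp only [OnBoard, ray] at h₀ h₁
  obtain ⟨hd₀, hd'⟩ := dirs_bounds hd
  refine hd₀ (Prod.ext ?_ ?_) <;> simp only [Prod.fst_zero, Prod.snd_zero] <;> omega

theorem exists_run {C : Finset (ℤ × ℤ)} {d : ℤ × ℤ} (hd : d ∈ dirs)
    (hC : ∀ P ∈ C, OnBoard 19 15 P) (P : ℤ × ℤ) : ∃ k, Run C P d k := by
  classical
  have h : ∃ k : ℕ, ray P d k ∉ C := by
    by_contra! h
    have h₀ := hC _ (h 0)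
    have h₁ := hC _ (h 19)
    simp only [OnBoard, ray] at h₀ h₁
    obtain ⟨hd₀, hd'⟩ := dirs_bounds hd
    refine hd₀ (Prod.ext ?_ ?_) <;> simp only [Prod.fst_zero, Prod.snd_zero] <;> omega
  exact ⟨Nat.find h, fun j hj => not_not.1 (Nat.find_min h hj), Nat.find_spec h⟩

/-- The number `e` encodes the direction `d`. -/
def DirCode (e : ℕ) (d : ℤ × ℤ) : Prop := (e : ℤ) = 17 + d.1 + 16 * d.2

theorem exists_dirCode (p : Player) {d : ℤ × ℤ} (hd : d ∈ dirs) :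
    ∃ e ∈ dirCodes p, DirCode e d := by
  revert d p
  unfold DirCode
  decide

theorem exists_dir (p : Player) {e : ℕ} (he : e ∈ dirCodes p) : ∃ d ∈ dirs, DirCode e d := by
  revert e p
  unfold DirCode
  decide

theorem Code.step {i e : ℕ} {P d : ℤ × ℤ} (hi : Code i P) (he : DirCode e d) (hd : d ∈ dirs)
    (h₁ : 1 ≤ P.1) (h₂ : 1 ≤ P.2) : Code (Nat.sub (Nat.add i e) 17) (ray P d 1) := by
  change ((i + e - 17 : ℕ) : ℤ) = _
  obtain ⟨-, hd'⟩ := dirs_bounds hd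
  unfold Code DirCode at *
  simp only [ray]
  omega

theorem slide_eq {e : ℕ} {d : ℤ × ℤ} (hd : d ∈ dirs) (he : DirCode e d) :
    ∀ {k f i c : ℕ} {P : ℤ × ℤ} {C : Finset (ℤ × ℤ)}, CodeSet c C → Code i P → 0 ≤ P.1 →
      P.1 ≤ 16 → Run C P d k → k < f → ∃ i' c', Code i' (ray P d k) ∧
        CodeSet c' (C \ (Finset.range k).image fun j : ℕ => ray P d j) ∧
        0 ≤ (ray P d k).1 ∧ (ray P d k).1 ≤ 16 ∧
        slide f e i c = cond (inColumns i') (some (i', c')) none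
  | 0, f + 1, i, c, P, C, hc, hi, h₁, h₂, hk, _ => by
    have hP := hk.2
    rw [Nat.cast_zero, ray_zero] at hP
    have hb : bit c i = false := by
      rwa [← Bool.not_eq_true, hc.bit_iff_mem hi h₁ h₂]
    refine ⟨i, c, by rwa [Nat.cast_zero, ray_zero], by simpa using hc, ?_, ?_, ?_⟩
    · rwa [Nat.cast_zero, ray_zero]
    · rwa [Nat.cast_zero, ray_zero]
    · rw [slide, hb, cond_false]
  | k + 1, f + 1, i, c, P, C, hc, hi, h₁, h₂, hk, hf => by
    have hP : P ∈ C := by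
      simpa [ray_zero] using hk.1 0 (by omega)
    have hon := hc.onBoard P hP
    have hstep := hi.step he hd hon.1 hon.2.2.1
    obtain ⟨hd₀, hd'⟩ := dirs_bounds hd
    have hshift : ∀ j : ℕ, ray (ray P d 1) d j = ray P d ((j + 1 : ℕ) : ℤ) := by
      intro j
      rw [ray_ray]
      congr 1
      push_cast
      ring
    have hne : ∀ j : ℕ, ray P d ((j + 1 : ℕ) : ℤ) ≠ P := by
      intro j hj
      simp only [ray, Prod.ext_iff] at hj
      refine hd₀ (Prod.ext ?_ ?_)
      · simpa [show (j : ℤ) + 1 ≠ 0 by omega] using hj.1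
      · simpa [show (j : ℤ) + 1 ≠ 0 by omega] using hj.2
    have hrun : Run (C.erase P) (ray P d 1) d k := by
      refine ⟨fun j hj => ?_, fun h => hk.2 ?_⟩
      · rw [hshift]
        exact Finset.mem_erase.2 ⟨hne j, hk.1 _ (by omega)⟩
      · rw [hshift] at h
        exact Finset.mem_of_mem_erase h
    unfold OnBoard at hon
    obtain ⟨i', c', hi', hc', h₃, h₄, h₅⟩ := slide_eq hd he (hc.erase hi hP) hstep
      (by simp only [ray]; omega) (by simp only [ray]; omega) hrun (by omega : k < f)
    rw [hshift] at hi' h₃ h₄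
    refine ⟨i', c', hi', ?_, h₃, h₄, ?_⟩
    · convert hc' using 1
      ext Q
      simp only [Finset.mem_sdiff, Finset.mem_image, Finset.mem_range, Finset.mem_erase, hshift,
        not_exists, not_and]
      constructor
      · rintro ⟨hQ, h⟩
        refine ⟨⟨fun hQP => h 0 (by omega) ?_, hQ⟩, fun j hj => h _ (by omega)⟩
        rw [Nat.cast_zero, ray_zero, hQP]
      · rintro ⟨⟨hQP, hQ⟩, h⟩
        refine ⟨hQ, fun j hj => ?_⟩
        cases j with
        | zero =>
          rw [Nat.cast_zero, ray_zero]
          exact Ne.symm hQP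
        | succ j => exact h j (by omega)
    · rw [slide, (hc.bit_iff_mem hi h₁ h₂).2 hP, cond_true, force_eq, force_eq, h₅]

theorem Code.inColumns_iff {i : ℕ} {P : ℤ × ℤ} (hi : Code i P) (h₁ : 0 ≤ P.1) (h₂ : P.1 ≤ 16) :
    inColumns i = true ↔ 1 ≤ P.1 ∧ P.1 ≤ 15 := by
  unfold Code at hi
  rw [Phutball.inColumns_iff]
  omega

theorem Codes.inRows_iff {b c : ℕ} {B : ℤ × ℤ} {C : Finset (ℤ × ℤ)} (h : Codes b c B C) :
    inRows b = true ↔ 1 ≤ B.2 ∧ B.2 ≤ 19 := by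
  obtain ⟨hb, h₁, h₂, -⟩ := h
  unfold Code at hb
  rw [Phutball.inRows_iff]
  omega

theorem Codes.live_iff {b c : ℕ} {B : ℤ × ℤ} {C : Finset (ℤ × ℤ)} (h : Codes b c B C) :
    live b = true ↔ 2 ≤ B.2 ∧ B.2 ≤ 18 := by
  obtain ⟨hb, h₁, h₂, -⟩ := h
  unfold Code at hb
  rw [Phutball.live_iff]
  omega

/-- A ball resting on `B` is won by `p`. -/
def WonBy (p : Player) (B : ℤ × ℤ) : Prop := ∀ s : PState, s.ball = B → winner 19 s = some p

theorem Codes.wonBy {b c : ℕ} {B : ℤ × ℤ} {C : Finset (ℤ × ℤ)} {p : Player} (h : Codes b c B C)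
    (hg : goal p b = true) : WonBy p B := by
  rintro s rfl
  obtain ⟨hb, h₁, h₂, -⟩ := h
  unfold Code at hb
  cases p
  · rw [goal, cond_false, Nat.blt_eq] at hg
    rw [winner, if_neg (by omega), if_pos (by omega)]
  · rw [goal, cond_true, Nat.ble_eq] at hg
    rw [winner, if_pos (by omega)]

theorem Codes.winner_eq_none {b c : ℕ} {s : PState} (h : Codes b c s.ball s.chaps)
    (hb : live b = true) : winner 19 s = none := by
  rw [h.live_iff] at hb
  rw [winner, if_neg (by omega), if_neg (by omega)]

theorem hop_iff_run {B B' : ℤ × ℤ} {C C' : Finset (ℤ × ℤ)} :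
    Hop 15 B C B' C' ↔ ∃ d ∈ dirs, ∃ k : ℕ, 1 ≤ k ∧ Run C (ray B d 1) d k ∧ 1 ≤ B'.1 ∧ B'.1 ≤ 15 ∧
      B' = ray B d (k + 1) ∧ C' = C \ (Finset.range k).image fun j : ℕ => ray (ray B d 1) d j := by
  refine exists_congr fun d => and_congr_right fun _ => exists_congr fun k =>
    and_congr_right fun _ => ?_
  have h₁ : (∀ i : ℕ, 1 ≤ i → i ≤ k → ray B d i ∈ C) ↔ ∀ j < k, ray (ray B d 1) d (j : ℕ) ∈ C := by
    constructor
    · intro h j hj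
      rw [ray_ray, add_comm]
      exact_mod_cast h (j + 1) (by omega) (by omega)
    · intro h i hi hik
      have := h (i - 1) (by omega)
      rwa [ray_ray, Nat.cast_sub hi, Nat.cast_one, add_sub_cancel] at this
  have h₂ : (Finset.range k).image (fun j : ℕ => ray (ray B d 1) d j) =
      (Finset.Icc 1 k).image fun i : ℕ => ray B d i := by
    rw [← Finset.Ico_succ_right_eq_Icc, Order.succ_eq_add_one, Finset.range_eq_Ico,
      ← Finset.image_add_right_Ico 0 k 1, Finset.image_image]
    refine Finset.image_congr fun j _ => ?_
    simp only [ray_ray, Function.comp_apply, Nat.cast_add, Nat.cast_one, add_comm]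
  rw [Run, h₁, h₂, ray_ray, add_comm 1 (k : ℤ)]
  constructor
  · rintro ⟨h₃, h₄, h₅, h₆, rfl, h₇⟩
    exact ⟨⟨h₃, h₄⟩, h₅, h₆, rfl, h₇⟩
  · rintro ⟨⟨h₃, h₄⟩, h₅, h₆, rfl, h₇⟩
    exact ⟨h₃, h₄, h₅, h₆, rfl, h₇⟩

section Hop

variable {b c e : ℕ} {B d : ℤ × ℤ} {C : Finset (ℤ × ℤ)}

theorem Codes.step (h : Codes b c B C) (hB : 1 ≤ B.2) (hd : d ∈ dirs) (he : DirCode e d) :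
    Code (Nat.sub (Nat.add b e) 17) (ray B d 1) ∧ 0 ≤ (ray B d 1).1 ∧ (ray B d 1).1 ≤ 16 := by
  refine ⟨h.ball.step he hd h.left hB, ?_⟩
  have := dirs_bounds hd
  have h₁ := h.left
  have h₂ := h.right
  simp only [ray]
  omega

theorem hop_eq_of_run (h : Codes b c B C) (hB : 1 ≤ B.2) (hd : d ∈ dirs) (he : DirCode e d)
    {k : ℕ} (hk : Run C (ray B d 1) d k) (hk₁ : 1 ≤ k) :
    ∃ b' c', Code b' (ray B d (k + 1)) ∧
      CodeSet c' (C \ (Finset.range k).image fun j : ℕ => ray (ray B d 1) d j) ∧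
      0 ≤ (ray B d (k + 1)).1 ∧ (ray B d (k + 1)).1 ≤ 16 ∧
      hop b c e = cond (inColumns b') (some (b', c')) none := by
  obtain ⟨hi, h₁, h₂⟩ := h.step hB hd he
  have hle := hk.le hd h.chaps.onBoard
  obtain ⟨i', c', hs⟩ := slide_eq hd he (f := 20) h.chaps hi h₁ h₂ hk (by omega)
  have hmem : ray B d 1 ∈ C := by
    simpa [ray_zero] using hk.1 0 hk₁
  rw [ray_ray, add_comm 1 (k : ℤ)] at hs
  refine ⟨i', c', hs.1, hs.2.1, hs.2.2.1, hs.2.2.2.1, ?_⟩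
  rw [hop, force_eq, (h.chaps.bit_iff_mem hi h₁ h₂).2 hmem, cond_true, hs.2.2.2.2]

theorem hop_complete (p : Player) (h : Codes b c B C) (hB : 1 ≤ B.2) {B' : ℤ × ℤ}
    {C' : Finset (ℤ × ℤ)} (hh : Hop 15 B C B' C') :
    ∃ e ∈ dirCodes p, ∃ r, hop b c e = some r ∧ Codes r.1 r.2 B' C' := by
  obtain ⟨d, hd, k, hk₁, hk, h₁, h₂, rfl, rfl⟩ := hop_iff_run.1 hh
  obtain ⟨e, hep, he⟩ := exists_dirCode p hd
  obtain ⟨b', c', hb', hc', h₃, h₄, heq⟩ := hop_eq_of_run h hB hd he hk hk₁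
  refine ⟨e, hep, (b', c'), ?_, hb', h₁, h₂, hc'⟩
  rw [heq, (hb'.inColumns_iff h₃ h₄).2 ⟨h₁, h₂⟩, cond_true]

theorem hop_sound {p : Player} (h : Codes b c B C) (hB : 1 ≤ B.2) (hep : e ∈ dirCodes p)
    {r : ℕ × ℕ} (hr : hop b c e = some r) :
    ∃ B' C', Hop 15 B C B' C' ∧ Codes r.1 r.2 B' C' := by
  obtain ⟨d, hd, he⟩ := exists_dir p hep
  obtain ⟨k, hk⟩ := exists_run hd h.chaps.onBoard (ray B d 1)
  rcases Nat.eq_zero_or_pos k with rfl | hk₁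
  · obtain ⟨hi, h₁, h₂⟩ := h.step hB hd he
    have hmem := hk.2
    rw [Nat.cast_zero, ray_zero, ← h.chaps.bit_iff_mem hi h₁ h₂, Bool.not_eq_true] at hmem
    rw [hop, force_eq, hmem, cond_false] at hr
    cases hr
  · obtain ⟨b', c', hb', hc', h₃, h₄, heq⟩ := hop_eq_of_run h hB hd he hk hk₁
    rw [heq] at hr
    have hcol : inColumns b' = true := by
      by_contra hcol
      rw [Bool.not_eq_true] at hcol
      rw [hcol] at hr
      cases hr
    rw [hcol, cond_true, Option.some_inj] at hr
    subst hr
    rw [hb'.inColumns_iff h₃ h₄] at hcol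
    exact ⟨_, _, hop_iff_run.2 ⟨d, hd, k, hk₁, hk, hcol.1, hcol.2, rfl, rfl⟩,
      hb', hcol.1, hcol.2, hc'⟩

theorem hop_mono {B' : ℤ × ℤ} {C' D : Finset (ℤ × ℤ)} (hh : Hop 15 B C B' C') (hCD : C ⊆ D)
    (hB' : B' ∉ D) : ∃ D', Hop 15 B D B' D' ∧ C' ⊆ D' ∧ ∀ P ∈ D', P ∉ C' → P ∈ D ∧ P ∉ C := by
  obtain ⟨d, hd, k, hk, h₁, h₂, h₃, h₄, rfl, rfl⟩ := hh
  refine ⟨_, ⟨d, hd, k, hk, fun i hi hik => hCD (h₁ i hi hik), hB', h₃, h₄, rfl, rfl⟩,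
    Finset.sdiff_subset_sdiff hCD le_rfl, fun P hP hPC => ?_⟩
  rw [Finset.mem_sdiff] at hP hPC
  exact ⟨hP.1, fun h => hPC ⟨h, hP.2⟩⟩

end Hop

theorem threat_sound {p : Player} : ∀ {f b c : ℕ} {l : List ℕ} {B : ℤ × ℤ}
    {C D : Finset (ℤ × ℤ)}, threat p f b c = some l → Codes b c B C → 1 ≤ B.2 → C ⊆ D →
      (∀ P ∈ D, P ∉ C → ∀ i ∈ l, ¬ Code i P) → ∃ B' D', Jump 19 15 B D B' D' ∧ WonBy p B'
  | 0, _, _, _, _, _, _, ht, _, _, _, _ => by simp [threat] at ht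
  | f + 1, b, c, l, B, C, D, ht, h, hB, hCD, hl => by
    rw [threat] at ht
    obtain ⟨e, he, ht⟩ := List.exists_of_findSome?_eq_some ht
    obtain ⟨r, hr, ht⟩ := Option.bind_eq_some_iff.1 ht
    obtain ⟨B', C', hh, h'⟩ := hop_sound h hB he hr
    have hmem : r.1 ∈ l → B' ∉ D := by
      intro hrl hB'
      refine hl B' hB' (fun hC => ?_) _ hrl h'.ball
      obtain ⟨d, _, k, _, _, hk, _, _, rfl, _⟩ := hh
      exact hk hC
    cases hg : goal p r.1
    · rw [hg, cond_false] at ht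
      cases hrow : inRows r.1
      · simp [hrow] at ht
      · rw [hrow, cond_true] at ht
        obtain ⟨l', hl', rfl⟩ := Option.map_eq_some_iff.1 ht
        obtain ⟨D', hD', hC'D', hD⟩ := hop_mono hh hCD (hmem List.mem_cons_self)
        rw [h'.inRows_iff] at hrow
        obtain ⟨B'', D'', hj, hw⟩ := threat_sound hl' h' hrow.1 hC'D' fun P hP hPC i hi =>
          hl P (hD P hP hPC).1 (hD P hP hPC).2 i (List.mem_cons_of_mem _ hi)
        exact ⟨B'', D'', .cons hD' hrow.1 hrow.2 hj, hw⟩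
    · rw [hg, cond_true, Option.some_inj] at ht
      subst ht
      obtain ⟨D', hD', -⟩ := hop_mono hh hCD (hmem List.mem_cons_self)
      exact ⟨B', D', .single hD', h'.wonBy hg⟩

theorem allJumps_sound {p : Player} {W : ℕ → ℕ → Bool} : ∀ {f b c : ℕ} {B B' : ℤ × ℤ}
    {C C' : Finset (ℤ × ℤ)}, allJumps p W f b c = true → Codes b c B C → 1 ≤ B.2 →
      Jump 19 15 B C B' C' →
      WonBy p B' ∨ ∃ b' c', live b' = true ∧ Codes b' c' B' C' ∧ W b' c' = true
  | 0, _, _, _, _, _, _, ha, _, _, _ => by simp [allJumps] at ha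
  | f + 1, b, c, B, B', C, C', ha, h, hB, hj => by
    rw [allJumps, List.all_eq_true] at ha
    cases hj with
    | single hh =>
      obtain ⟨e, he, r, hr, h'⟩ := hop_complete p h hB hh
      have := ha e he
      rw [hr, Option.all_some] at this
      cases hlive : live r.1
      · rw [hlive, cond_false] at this
        refine .inl (h'.wonBy ?_)
        by_contra hg
        simp [hg] at this
      · rw [hlive, cond_true] at this
        refine .inr ⟨r.1, r.2, hlive, h', ?_⟩
        by_contra hW
        simp [hW] at this
    | cons hh h₁ h₂ hj =>
      obtain ⟨e, he, r, hr, h'⟩ := hop_complete p h hB hh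
      have := ha e he
      rw [hr, Option.all_some, h'.inRows_iff.2 ⟨h₁, h₂⟩, cond_true, Bool.cond_false_right,
        Bool.and_eq_true] at this
      exact allJumps_sound this.2 h' h₁ hj

theorem safe_sound {p : Player} {b c : ℕ} {B B' : ℤ × ℤ} {C D D' : Finset (ℤ × ℤ)}
    (hs : safe p b c = true) (h : Codes b c B C) (hB : 1 ≤ B.2) (hCD : C ⊆ D)
    (hD : ∀ P ∈ D, OnBoard 19 15 P) (hn : ∀ d ∈ dirs, ray B d 1 ∈ D → ray B d 1 ∈ C)
    (hj : Jump 19 15 B D B' D') : WonBy p B' := by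
  rw [safe, List.all_eq_true] at hs
  have hC : ∀ {B' C'}, Hop 15 B C B' C' → WonBy p B' ∧ ¬ (1 ≤ B'.2 ∧ B'.2 ≤ 19) := by
    intro B' C' hh
    obtain ⟨e, he, r, hr, h'⟩ := hop_complete p h hB hh
    have := hs e he
    rw [hr, Option.all_some] at this
    rw [← h'.inRows_iff]
    cases hrow : inRows r.1
    · rw [hrow, cond_false] at this
      exact ⟨h'.wonBy this, Bool.false_ne_true⟩
    · simp [hrow] at this
  have hop_of_hop : ∀ {B' D'}, Hop 15 B D B' D' → ∃ C', Hop 15 B C B' C' := by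
    intro B' D' hh
    obtain ⟨d, hd, k, hk₁, hk, h₁, h₂, rfl, rfl⟩ := hop_iff_run.1 hh
    obtain ⟨l, hl⟩ := exists_run hd h.chaps.onBoard (ray B d 1)
    have hl₁ : 1 ≤ l := by
      by_contra! hl₀
      rw [Nat.lt_one_iff.1 hl₀] at hl
      have h₃ := hl.2
      have h₄ := hk.1 0 hk₁
      rw [Nat.cast_zero, ray_zero] at h₃ h₄
      exact h₃ (hn d hd h₄)
    by_cases hlD : ray (ray B d 1) d l ∈ D
    · have hon := hD _ hlD
      rw [ray_ray, add_comm] at hon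
      exact absurd ⟨hon.2.2.1, hon.2.2.2⟩
        (hC (hop_iff_run.2 ⟨d, hd, l, hl₁, hl, hon.1, hon.2.1, rfl, rfl⟩)).2
    · have : k = l := hk.eq ⟨fun j hj => hCD (hl.1 j hj), hlD⟩
      subst this
      exact ⟨_, hop_iff_run.2 ⟨d, hd, k, hk₁, hl, h₁, h₂, rfl, rfl⟩⟩
  cases hj with
  | single hh =>
    obtain ⟨C', hh'⟩ := hop_of_hop hh
    exact (hC hh').1
  | cons hh h₁ h₂ hj =>
    obtain ⟨C', hh'⟩ := hop_of_hop hh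
    exact absurd ⟨h₁, h₂⟩ (hC hh').2

/-- Player `p` can force a win within `n` moves. -/
def ForcesIn (p : Player) : ℕ → PState → Prop
  | 0, s => winner 19 s = some p
  | n + 1, s => winner 19 s = some p ∨ winner 19 s = none ∧
    (s.turn = p ∧ (∃ t, MoveRel 19 15 s t ∧ ForcesIn p n t) ∨
      s.turn = !p ∧ (∃ t, MoveRel 19 15 s t) ∧ ∀ t, MoveRel 19 15 s t → ForcesIn p n t)

theorem ForcesIn.of_winner {p : Player} {s : PState} (h : winner 19 s = some p) (n : ℕ) :
    ForcesIn p n s := by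
  cases n
  · exact h
  · exact .inl h

theorem ForcesIn.succ {p : Player} : ∀ {n : ℕ} {s : PState}, ForcesIn p n s → ForcesIn p (n + 1) s
  | 0, _, h => .of_winner h 1
  | _ + 1, _, .inl h => .inl h
  | _ + 1, _, .inr ⟨h, .inl ⟨ht, t, hst, hn⟩⟩ => .inr ⟨h, .inl ⟨ht, t, hst, hn.succ⟩⟩
  | _ + 1, _, .inr ⟨h, .inr ⟨ht, hm, hn⟩⟩ =>
    .inr ⟨h, .inr ⟨ht, hm, fun t hst => (hn t hst).succ⟩⟩

theorem ForcesIn.mono {p : Player} {m n : ℕ} {s : PState} (hmn : m ≤ n) (h : ForcesIn p m s) :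
    ForcesIn p n s := by
  induction hmn with
  | refl => exact h
  | step _ ih => exact ih.succ

theorem ForcesIn.winsFrom {p : Player} {n : ℕ} {s : PState} (h : ForcesIn p n s) :
    WinsFrom 19 15 p s := by
  classical
  let Good (s : PState) (n : ℕ) : Prop := ∃ t, MoveRel 19 15 s t ∧ ForcesIn p n t
  have hex : ∀ s, ∃ t, ((∃ t, MoveRel 19 15 s t) → MoveRel 19 15 s t) ∧
      ∀ n, Good s n → ForcesIn p n t := by
    intro s
    by_cases hg : ∃ n, Good s n
    · obtain ⟨t, hst, ht⟩ := Nat.find_spec hg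
      exact ⟨t, fun _ => hst, fun n hn => ht.mono (Nat.find_min' hg hn)⟩
    · by_cases hm : ∃ t, MoveRel 19 15 s t
      · obtain ⟨t, hst⟩ := hm
        exact ⟨t, fun _ => hst, fun n hn => absurd ⟨n, hn⟩ hg⟩
      · exact ⟨s, fun hm' => absurd hm' hm, fun n hn => absurd ⟨n, hn⟩ hg⟩
  choose σ hσ₁ hσ₂ using hex
  refine ⟨σ, fun s _ _ => hσ₁ s, fun f hf hf₀ hσ => ?_⟩
  suffices ∀ n k, ForcesIn p n (f k) → ∃ k, winner 19 (f k) = some p from this n 0 (hf₀ ▸ h)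
  intro n
  induction n with
  | zero => exact fun k hk => ⟨k, hk⟩
  | succ n ih =>
    rintro k (hk | ⟨hw, ⟨ht, t, hst, hn⟩ | ⟨-, hm, hn⟩⟩)
    · exact ⟨k, hk⟩
    · refine ih (k + 1) ?_
      rw [hσ k ht hw ⟨t, hst⟩]
      exact hσ₂ _ n ⟨t, hst, hn⟩
    · rcases hf k with ⟨-, -, hmove⟩ | ⟨hw' | hm', -⟩
      · exact ih (k + 1) (hn _ hmove)
      · exact absurd hw hw'
      · exact absurd hm hm'

theorem exists_code {B : ℤ × ℤ} (hB : OnBoard 19 15 B) :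
    ∃ q, Code q B ∧ inRows q = true ∧ inColumns q = true ∧ q < 320 := by
  unfold OnBoard at hB
  refine ⟨(16 * B.2 + B.1).toNat, ?_⟩
  rw [inRows_iff, inColumns_iff]
  unfold Code
  omega

theorem exists_point {q : ℕ} (h₁ : inRows q = true) (h₂ : inColumns q = true) :
    ∃ P, Code q P ∧ OnBoard 19 15 P := by
  rw [inRows_iff] at h₁
  rw [inColumns_iff] at h₂
  refine ⟨((q % 16 : ℕ), (q / 16 : ℕ)), ?_⟩
  unfold Code OnBoard
  dsimp only
  omega

section Game

variable {p : Player} {n b c q : ℕ} {s t : PState} {W : ℕ → ℕ → Bool}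

theorem Codes.move (h : Codes b c s.ball s.chaps) (hst : MoveRel 19 15 s t) :
    (∃ q P, q < 320 ∧ Code q P ∧ OnBoard 19 15 P ∧ vacant b c q = true ∧ t.ball = s.ball ∧
      t.chaps = insert P s.chaps ∧ Codes b (toggle c q) t.ball t.chaps) ∨
    Jump 19 15 s.ball s.chaps t.ball t.chaps := by
  refine hst.2.imp ?_ id
  rintro ⟨P, hP, hPC, hPB, hb, hc⟩
  obtain ⟨q, hq, hq₁, hq₂, hq₃⟩ := exists_code hP
  refine ⟨q, P, hq₃, hq, hP, ?_, hb, hc, ?_⟩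
  · rw [vacant_iff, ← Bool.not_eq_true,
      h.chaps.bit_iff_mem hq (by linarith [hP.1]) (by linarith [hP.2.1])]
    refine ⟨hq₁, hq₂, hPC, ?_⟩
    rintro rfl
    exact hPB (hq.eq h.ball (by linarith [hP.1]) (by linarith [hP.2.1]) h.left h.right)
  · rw [hb, hc]
    exact ⟨h.ball, h.left, h.right, h.chaps.insert hq hP hPC⟩

theorem Codes.exists_move (h : Codes b c s.ball s.chaps) (hq : vacant b c q = true) :
    ∃ P, Code q P ∧ OnBoard 19 15 P ∧ P ∉ s.chaps ∧
      MoveRel 19 15 s ⟨s.ball, insert P s.chaps, !s.turn⟩ ∧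
      Codes b (toggle c q) s.ball (insert P s.chaps) := by
  obtain ⟨hq₁, hq₂, hq₃, hq₄⟩ := (vacant_iff ..).1 hq
  obtain ⟨P, hqP, hP⟩ := exists_point hq₁ hq₂
  have hPC : P ∉ s.chaps := by
    rwa [← h.chaps.bit_iff_mem hqP (by linarith [hP.1]) (by linarith [hP.2.1]), Bool.not_eq_true]
  refine ⟨P, hqP, hP, hPC, ⟨rfl, .inl ⟨P, hP, hPC, ?_, rfl, rfl⟩⟩,
    h.ball, h.left, h.right, h.chaps.insert hqP hP hPC⟩
  rintro rfl
  have := h.ball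
  unfold Code at hqP this
  omega

theorem okPlace_sound (h : okPlace W b c q = true) (hq : vacant b c q = true) :
    W b (toggle c q) = true := by
  rwa [okPlace, hq, cond_true, force_eq] at h

theorem allMoves_sound (ha : allMoves p W b c = true) (hlive : live b = true)
    (h : Codes b c s.ball s.chaps) (hst : MoveRel 19 15 s t) :
    winner 19 t = some p ∨
      ∃ b' c', live b' = true ∧ Codes b' c' t.ball t.chaps ∧ W b' c' = true := by
  rw [allMoves, Bool.cond_false_right, Bool.and_eq_true, List.all_eq_true] at ha
  obtain ⟨q, P, hq, -, -, hv, -, -, h'⟩ | hj := h.move hst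
  · exact .inr ⟨b, _, hlive, h', okPlace_sound (ha.2 q (List.mem_range.2 hq)) hv⟩
  · have := h.live_iff.1 hlive
    exact (allJumps_sound ha.1 h (by omega) hj).imp_left fun hw => hw t rfl

/-- The test `W` only accepts positions from which `p`, who is to move, can force a win within `n`
moves. -/
def Sound (p : Player) (n : ℕ) (W : ℕ → ℕ → Bool) : Prop :=
  ∀ ⦃b c : ℕ⦄ ⦃s : PState⦄, live b = true → Codes b c s.ball s.chaps → s.turn = p →
    W b c = true → ForcesIn p n s

theorem ForcesIn.of_jump (hlive : live b = true) (h : Codes b c s.ball s.chaps)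
    (ht : s.turn = p) {B' : ℤ × ℤ} {C' : Finset (ℤ × ℤ)}
    (hj : Jump 19 15 s.ball s.chaps B' C') (hw : WonBy p B') : ForcesIn p 1 s :=
  .inr ⟨h.winner_eq_none hlive, .inl ⟨ht, ⟨B', C', !s.turn⟩, ⟨rfl, .inr hj⟩, hw _ rfl⟩⟩

theorem sound_canJump : Sound p 1 (canJump p) := by
  intro b c s hlive h ht hW
  obtain ⟨l, hl⟩ := Option.isSome_iff_exists.1 hW
  have := h.live_iff.1 hlive
  obtain ⟨B', C', hj, hw⟩ := threat_sound hl h (by omega) Finset.Subset.rfl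
    fun P hP hP' => absurd hP hP'
  exact .of_jump hlive h ht hj hw

/-- Every position accepted by `L`, with the opponent of `p` to move, can be won by `p` within `n`
moves. -/
def SoundReply (p : Player) (n : ℕ) (L : ℕ → ℕ → Bool) : Prop :=
  ∀ ⦃b c : ℕ⦄ ⦃s : PState⦄, live b = true → Codes b c s.ball s.chaps → s.turn = !p →
    L b c = true → ForcesIn p n s

theorem SoundReply.canPlace {L : ℕ → ℕ → Bool} (hL : SoundReply p n L) :
    Sound p (n + 1) fun b c => canPlace L b c q := by
  intro b c s hlive h ht hW
  simp only [Phutball.canPlace, Bool.cond_false_right, Bool.and_eq_true, force_eq] at hW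
  obtain ⟨P, -, -, -, hst, h'⟩ := h.exists_move hW.1
  exact .inr ⟨h.winner_eq_none hlive, .inl ⟨ht, _, hst, hL hlive h' (by rw [ht]) hW.2⟩⟩

theorem Sound.forced (hW : Sound p (n + 1) W) : SoundReply p (n + 2) (forced p W) := by
  intro b c s hlive h ht hf
  rw [Phutball.forced, Bool.cond_false_right, Bool.and_eq_true, Option.any_eq_true] at hf
  obtain ⟨hjumps, l, hl, hok⟩ := hf
  rw [List.all_eq_true] at hok
  have hB := h.live_iff.1 hlive
  refine .inr ⟨h.winner_eq_none hlive, .inr ⟨ht, ?_, fun t hst => ?_⟩⟩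
  · obtain ⟨B', C', hj, -⟩ := threat_sound hl h (by omega) Finset.Subset.rfl
      fun P hP hP' => absurd hP hP'
    exact ⟨⟨B', C', !s.turn⟩, rfl, .inr hj⟩
  have htt : t.turn = p := by rw [hst.1, ht, Bool.not_not]
  obtain ⟨q, P, hq, hqP, hP, hv, hb, hc, h'⟩ | hj := h.move hst
  · by_cases hql : q ∈ l
    · exact hW hlive h' htt (okPlace_sound (hok q hql) hv)
    · obtain ⟨B', C', hj, hw⟩ := threat_sound (D := t.chaps) hl h (by omega)
        (hc ▸ Finset.subset_insert _ _) (by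
          rw [hc]
          intro Q hQ hQs i hi hiQ
          obtain rfl := (Finset.mem_insert.1 hQ).resolve_right hQs
          refine hql ?_
          have : q = i := by unfold Code at hqP hiQ; omega
          rwa [this])
      rw [← hb] at hj
      exact (ForcesIn.of_jump hlive h' htt hj hw).mono (by omega)
  · obtain hw | ⟨b', c', hlive', h', hW'⟩ := allJumps_sound hjumps h (by omega) hj
    · exact .of_winner (hw t rfl) _
    · exact hW hlive' h' htt hW'

theorem sound_wins : ∀ hs : List (List ℕ), Sound p (2 * hs.length + 1) (wins p hs)
  | [] => sound_canJump
  | l :: hs => by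
    intro b c s hlive h ht hW
    rw [wins, List.any_eq_true] at hW
    obtain ⟨q, -, hq⟩ := hW
    cases hq₀ : Nat.beq q 0
    · rw [hq₀, cond_false] at hq
      exact (sound_wins hs).forced.canPlace hlive h ht hq
    · rw [hq₀, cond_true] at hq
      exact (sound_canJump hlive h ht hq).mono (by omega)

theorem soundReply_quiet : SoundReply p 4 (quiet p q) := by
  intro b c s hlive h ht hW
  have hB := h.live_iff.1 hlive
  simp only [quiet, force_eq, Bool.cond_false_right, Bool.and_eq_true, Option.any_eq_true,
    List.all_eq_true, Nat.ble_eq] at hW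
  obtain ⟨hv, hsafe, hsafe', ⟨l, hl, hl'⟩, hok⟩ := hW
  obtain ⟨Q, hqQ, hQ, hQC, hmove, hQcodes⟩ := h.exists_move hv
  have hthreat : ∀ D, insert Q s.chaps ⊆ D → (∀ P ∈ D, OnBoard 19 15 P) →
      ∃ B' D', Jump 19 15 s.ball D B' D' ∧ WonBy p B' := by
    refine fun D hD hD' => threat_sound hl hQcodes (by omega) hD fun P hP _ i hi hiP => ?_
    have h₁ := hl' i hi
    have h₂ := hD' P hP
    unfold OnBoard at h₂
    unfold Code at hiP
    omega
  refine .inr ⟨h.winner_eq_none hlive, .inr ⟨ht, ⟨_, hmove⟩, fun t hst => ?_⟩⟩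
  have htt : t.turn = p := by rw [hst.1, ht, Bool.not_not]
  obtain ⟨r, P, hr, hrP, hP, hrv, hb, hc, h'⟩ | hj := h.move hst
  swap
  · exact .of_winner (safe_sound hsafe h (by omega) Finset.Subset.rfl h.chaps.onBoard
      (fun _ _ => id) hj t rfl) _
  by_cases hnear : ∃ d ∈ dirs, ray s.ball d 1 = P
  · obtain ⟨d, hd, rfl⟩ := hnear
    obtain ⟨e, hep, he⟩ := exists_dirCode p hd
    have hre : r = Nat.sub (Nat.add b e) 17 := by
      have := (h.step (by omega) hd he).1
      unfold Code at this hrP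
      omega
    subst hre
    exact (sound_canJump hlive h' htt (okPlace_sound (hok e hep) hrv)).mono (by decide)
  by_cases hPQ : P = Q
  · subst hPQ
    obtain ⟨B', D', hj, hw⟩ := hthreat t.chaps hc.ge h'.chaps.onBoard
    rw [← hb] at hj
    exact (ForcesIn.of_jump hlive h' htt hj hw).mono (by decide)
  have hQt : Q ∉ t.chaps := by
    rw [hc, Finset.mem_insert, not_or]
    exact ⟨Ne.symm hPQ, hQC⟩
  have hQB : Q ≠ t.ball := by
    rintro rfl
    have h₁ := h'.ball
    have h₂ := ((vacant_iff ..).1 hv).2.2.2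
    unfold Code at h₁ hqQ
    omega
  have hcodes : Codes b (toggle (toggle c r) q) t.ball (insert Q t.chaps) :=
    ⟨h'.ball, h'.left, h'.right, h'.chaps.insert hqQ hQ hQt⟩
  have hsub : insert Q s.chaps ⊆ insert Q t.chaps := by
    rw [hc]
    exact Finset.insert_subset_insert _ (Finset.subset_insert _ _)
  refine .inr ⟨h'.winner_eq_none hlive, .inl ⟨htt, ⟨t.ball, insert Q t.chaps, !t.turn⟩,
    ⟨rfl, .inl ⟨Q, hQ, hQt, hQB, rfl, rfl⟩⟩, ?_⟩⟩
  refine .inr ⟨hcodes.winner_eq_none hlive, .inr ⟨by rw [htt], ?_, fun u hu => ?_⟩⟩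
  · obtain ⟨B', D', hj, -⟩ := hthreat _ hsub hcodes.chaps.onBoard
    rw [← hb] at hj
    exact ⟨⟨B', D', p⟩, by rw [htt, Bool.not_not], .inr hj⟩
  obtain ⟨i, R, -, -, -, -, hub, huc, hu'⟩ | hj := hcodes.move hu
  · obtain ⟨B', D', hj, hw⟩ := hthreat u.chaps
      (hsub.trans (huc ▸ Finset.subset_insert _ _)) hu'.chaps.onBoard
    rw [← hb, ← hub] at hj
    exact .of_jump hlive hu' (by rw [hu.1, htt, Bool.not_not]) hj hw
  · rw [hb] at hj
    refine .of_winner (safe_sound hsafe' hQcodes (by omega) hsub hcodes.chaps.onBoard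
      (fun d hd hd' => ?_) hj u rfl) _
    rw [hc, Finset.insert_comm, Finset.mem_insert] at hd'
    exact hd'.resolve_left fun h => hnear ⟨d, hd, h⟩

end Game

/-- A player cannot force a win from an invariant set of positions that the opponent can maintain
and that contains no position won by the player. -/
theorem not_winsFrom_of_invariant {p : Player} {I : PState → Prop}
    (hI : ∀ s, I s → winner 19 s ≠ some p)
    (hopp : ∀ s, I s → winner 19 s = none → s.turn = (!p) → ∃ t, MoveRel 19 15 s t ∧ I t)
    (hown : ∀ s t, I s → winner 19 s = none → s.turn = p → MoveRel 19 15 s t → I t)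
    {s : PState} (hs : I s) : ¬ WinsFrom 19 15 p s := by
  classical
  rintro ⟨σ, hσ, hwin⟩
  have hex : ∀ s, ∃ t,
      ((winner 19 s = none ∧ (∃ t, MoveRel 19 15 s t) ∧ MoveRel 19 15 s t) ∨
        ((winner 19 s ≠ none ∨ ¬ ∃ t, MoveRel 19 15 s t) ∧ t = s)) ∧
      (s.turn = p → winner 19 s = none → (∃ t, MoveRel 19 15 s t) → t = σ s) ∧ (I s → I t) := by
    intro s
    by_cases hw : winner 19 s = none
    · by_cases hm : ∃ t, MoveRel 19 15 s t
      · by_cases ht : s.turn = p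
        · have hst := hσ s ht hw hm
          exact ⟨σ s, .inl ⟨hw, hm, hst⟩, fun _ _ _ => rfl, fun h => hown s _ h hw ht hst⟩
        · obtain ⟨t, hst, hIt⟩ : ∃ t, MoveRel 19 15 s t ∧ (I s → I t) := by
            by_cases hIs : I s
            · obtain ⟨t, hst, hIt⟩ := hopp s hIs hw (Bool.eq_not_of_ne ht)
              exact ⟨t, hst, fun _ => hIt⟩
            · obtain ⟨t, hst⟩ := hm
              exact ⟨t, hst, fun h => absurd h hIs⟩
          exact ⟨t, .inl ⟨hw, hm, hst⟩, fun h => absurd h ht, hIt⟩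
      · exact ⟨s, .inr ⟨.inr hm, rfl⟩, fun _ _ h => absurd h hm, id⟩
    · exact ⟨s, .inr ⟨.inl hw, rfl⟩, fun _ h => absurd h hw, id⟩
  choose next hplay hfollow hnext using hex
  have hsucc : ∀ k, next^[k + 1] s = next (next^[k] s) := fun k =>
    Function.iterate_succ_apply' next k s
  have hinv : ∀ k, I (next^[k] s) := by
    intro k
    induction k with
    | zero => exact hs
    | succ k ih =>
      rw [hsucc]
      exact hnext _ ih
  obtain ⟨k, hk⟩ := hwin (fun k => next^[k] s)
    (fun k => by simpa only [hsucc] using hplay (next^[k] s)) rfl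
    (fun k => by simpa only [hsucc] using hfollow (next^[k] s))
  exact hI _ (hinv k) hk

theorem eqPos_iff {r : ℕ × ℕ} {b c : ℕ} : eqPos r b c = true ↔ b = r.1 ∧ c = r.2 := by
  rw [eqPos, Bool.cond_false_right, Bool.and_eq_true, Nat.beq_eq, Nat.beq_eq]

/-- The position `s` occurs in the drawing cycle. -/
def InCycle (s : PState) : Prop :=
  ∃ j < 26, Codes (cycle j).1 (cycle j).2 s.ball s.chaps ∧ s.turn = Nat.beq (j % 2) 0

theorem InCycle.exists_move {s : PState} (h : InCycle s) (ht : s.turn = true) :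
    ∃ t, MoveRel 19 15 s t ∧ InCycle t := by
  obtain ⟨j, hj, hs, htj⟩ := h
  have hj₂ : j % 2 = 0 := by rwa [ht, eq_comm, Nat.beq_eq] at htj
  have hturn : (!s.turn) = Nat.beq ((j + 1) % 2) 0 := by
    rw [ht, Nat.add_mod, hj₂]
    rfl
  have hmove := cycleMove_even (j / 2) (by omega)
  have hlive := live_cycle j hj
  rw [show 2 * (j / 2) = j by omega, cycleMove] at hmove
  cases hj₁₂ : Nat.beq j 12
  · rw [hj₁₂, cond_false, canPlace, Bool.cond_false_right, Bool.and_eq_true, force_eq,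
      eqPos_iff] at hmove
    obtain ⟨hv, hb, hc⟩ := hmove
    obtain ⟨P, -, -, -, hst, h'⟩ := hs.exists_move hv
    rw [hc, hb] at h'
    exact ⟨_, hst, j + 1, by omega, h', hturn⟩
  · obtain rfl := Nat.eq_of_beq_eq_true hj₁₂
    rw [hj₁₂, cond_true, Option.any_eq_true] at hmove
    obtain ⟨r, hr, hr'⟩ := hmove
    rw [eqPos_iff] at hr'
    have hB := hs.live_iff.1 hlive
    obtain ⟨B', C', hh, h'⟩ := hop_sound (p := true) hs (by omega) (by decide) hr
    rw [hr'.1, hr'.2] at h'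
    exact ⟨⟨B', C', !s.turn⟩, ⟨rfl, .inr (.single hh)⟩, 13, by omega, h', hturn⟩

theorem reply_sound {j b c : ℕ} {s : PState} (hj₂ : j % 2 = 1)
    (hr : reply j b c = true) (hlive : live b = true) (h : Codes b c s.ball s.chaps)
    (ht : s.turn = true) : InCycle s ∨ ∃ n, ForcesIn true n s := by
  simp only [reply, Bool.cond_true_left, Bool.cond_false_right, Bool.or_eq_true, Bool.and_eq_true,
    eqPos_iff] at hr
  obtain ⟨hb, hc⟩ | ⟨-, hr | hr⟩ | hr := hr
  · rw [hb, hc] at h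
    refine .inl ⟨_, Nat.mod_lt _ (by norm_num), h, ?_⟩
    rw [ht, eq_comm, Nat.beq_eq]
    change (j + 1) % 26 % 2 = 0
    omega
  · exact .inr ⟨_, sound_canJump hlive h ht hr⟩
  · exact .inr ⟨_, soundReply_quiet.canPlace hlive h ht hr⟩
  · exact .inr ⟨_, sound_wins _ hlive h ht hr⟩

theorem InCycle.reply {s t : PState} (h : InCycle s) (ht : s.turn = false)
    (hst : MoveRel 19 15 s t) : InCycle t ∨ ∃ n, ForcesIn true n t := by
  obtain ⟨j, hj, hs, htj⟩ := h
  have hj₂ : j % 2 = 1 := by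
    rw [ht] at htj
    have := Nat.ne_of_beq_eq_false htj.symm
    omega
  have hall := allMoves_odd (j / 2) (by omega)
  rw [show 2 * (j / 2) + 1 = j by omega] at hall
  obtain hw | ⟨b, c, hlive, h', hr⟩ := allMoves_sound hall (live_cycle j hj) hs hst
  · exact .inr ⟨0, hw⟩
  · exact reply_sound hj₂ hr hlive h' (by rw [hst.1, ht, Bool.not_false])

theorem InCycle.not_winsFrom {s : PState} (h : InCycle s) : ¬ WinsFrom 19 15 false s := by
  refine not_winsFrom_of_invariant (I := fun s => InCycle s ∨ ∃ n, ForcesIn true n s)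
    ?_ ?_ ?_ (.inl h)
  · rintro s (⟨j, hj, hs, -⟩ | ⟨n, hn⟩) hw
    · rw [hs.winner_eq_none (live_cycle j hj)] at hw
      cases hw
    · cases n with
      | zero => cases hw.symm.trans hn
      | succ n =>
        obtain hn | hn := hn
        · cases hw.symm.trans hn
        · cases hw.symm.trans hn.1
  · rintro s (hs | ⟨n, hn⟩) hw ht
    · obtain ⟨t, hst, ht⟩ := hs.exists_move ht
      exact ⟨t, hst, .inl ht⟩
    · cases n with
      | zero => cases hw.symm.trans hn
      | succ n =>
        obtain hn | ⟨-, ⟨-, t, hst, hn⟩ | ⟨ht', -⟩⟩ := hn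
        · cases hw.symm.trans hn
        · exact ⟨t, hst, .inr ⟨n, hn⟩⟩
        · cases ht.symm.trans ht'
  · rintro s t (hs | ⟨n, hn⟩) hw ht hst
    · exact hs.reply ht hst
    · cases n with
      | zero => cases hw.symm.trans hn
      | succ n =>
        obtain hn | ⟨-, ⟨ht', -⟩ | ⟨-, -, hn⟩⟩ := hn
        · cases hw.symm.trans hn
        · cases ht.symm.trans ht'
        · exact .inr ⟨n, hn t hst⟩

theorem codeSet_R0chaps : CodeSet r0 R0chaps where
  onBoard := by
    unfold OnBoard
    decide +kernel
  bit_iff i := by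
    rcases lt_or_ge i 320 with hi | hi
    · have h : ∀ i < 320, bit r0 i = true ↔ ∃ P ∈ R0chaps, (i : ℤ) = 16 * P.2 + P.1 := by
        decide +kernel
      exact h i hi
    · have hb : bit r0 i = false := by
        rw [bit_eq_testBit]
        exact Nat.testBit_eq_false_of_lt
          (lt_of_lt_of_le (b := 2 ^ 352) (by decide +kernel)
            (Nat.pow_le_pow_right (by norm_num) (by omega)))
      have hon : ∀ P ∈ R0chaps, OnBoard 19 15 P := by
        unfold OnBoard
        decide +kernel
      refine iff_of_false (by rw [hb]; exact Bool.false_ne_true) fun ⟨P, hP, hiP⟩ => ?_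
      have := hon P hP
      unfold OnBoard at this
      unfold Code at hiP
      omega

theorem codes_R2 : Codes (cycle 2).1 (cycle 2).2 R2.ball R2.chaps where
  ball := rfl
  left := le_rfl
  right := by decide
  chaps := by
    have h₁ : CodeSet (toggle r0 (pt 2 3)) (insert (2, 3) R0chaps) :=
      codeSet_R0chaps.insert rfl (by unfold OnBoard; decide) (by decide +kernel)
    have h₂ : CodeSet (toggle (toggle r0 (pt 2 3)) (pt 3 4))
        (insert (3, 4) (insert (2, 3) R0chaps)) :=
      h₁.insert rfl (by unfold OnBoard; decide) (by decide +kernel)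
    have h₃ : R2.chaps = insert (3, 4) (insert (2, 3) R0chaps) := by
      rw [R2, Finset.union_comm, Finset.pair_comm]
      exact (Finset.insert_union ..).trans (congrArg _ (Finset.singleton_union ..))
    rw [h₃]
    exact h₂

theorem codes_R2_d5 : Codes (cycle 3).1 (cycle 3).2 R2_d5.ball R2_d5.chaps where
  ball := rfl
  left := le_rfl
  right := by decide
  chaps := codes_R2.chaps.insert (i := pt 4 5) rfl (by unfold OnBoard; decide) (by decide +kernel)

theorem moveRel_R2_R2_d5 : MoveRel 19 15 R2 R2_d5 :=
  ⟨rfl, .inl ⟨(4, 5), by unfold OnBoard; decide, by decide +kernel, by decide, rfl, rfl⟩⟩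

theorem winsFrom_of_ne_R2_d5 {t : PState} (ht : MoveRel 19 15 R2 t) (hne : t ≠ R2_d5) :
    WinsFrom 19 15 false t := by
  obtain hw | ⟨b, c, hlive, h, hr⟩ := allMoves_sound allMoves_R2 (live_cycle 2 (by norm_num))
    codes_R2 ht
  · exact ForcesIn.winsFrom (n := 0) hw
  · rw [replyR2, Bool.cond_true_left, Bool.or_eq_true, eqPos_iff] at hr
    obtain ⟨rfl, rfl⟩ | hr := hr
    · refine absurd ?_ hne
      have hb : t.ball = R2_d5.ball := h.ball.eq codes_R2_d5.ball (by linarith [h.left])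
        (by linarith [h.right]) codes_R2_d5.left codes_R2_d5.right
      have hc : t.chaps = R2_d5.chaps := h.chaps.eq codes_R2_d5.chaps
      cases t
      cases hb
      cases hc
      cases ht.1
      rfl
    · exact (sound_wins _ hlive h ht.1 hr).winsFrom

end Phutball

/-- From `R2` (on the official 19 × 15 pitch), placing a chap at d5 is Alfred's
unique non-losing move: it is legal; after it, Betty has no winning strategy
from the resulting position; and every other legal move of Alfred from `R2`
leads to a position from which Betty has a winning strategy. -/
theorem R2_unique_nonlosing :
    MoveRel 19 15 R2 R2_d5 ∧
    ¬ WinsFrom 19 15 false R2_d5 ∧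
    ∀ t, MoveRel 19 15 R2 t → t ≠ R2_d5 → WinsFrom 19 15 false t :=
  ⟨Phutball.moveRel_R2_R2_d5,
    Phutball.InCycle.not_winsFrom ⟨3, by norm_num, Phutball.codes_R2_d5, rfl⟩,
    fun _ ht hne => Phutball.winsFrom_of_ne_R2_d5 ht hne⟩
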